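/- For every n ≥ 1 and κ > 0, birational order filter rowmotion of A^n satisfies (Row^B_F)^{n+1} = Flip: for every π ∈ F^B_κ(A^n) and every p ∈ A^n, ((Row^B_F)^{n+1} π)(p) = π(Flip(p)). -/

import Mathlib

open scoped Classical

noncomputable section

/-- `P̂`: the poset `P` with a new minimum `0̂` and a new maximum `1̂` adjoined. -/
abbrev Phat (P : Type) := WithBot (WithTop P)

instance {P : Type} [Fintype P] : Fintype (Phat P) :=
  inferInstanceAs (Fintype (Option (Option P)))

/-- The inclusion of `P` into `P̂`. -/
def emb {P : Type} (p : P) : Phat P := ((p : WithTop P) : WithBot (WithTop P))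

/-- The new maximum `1̂` of `P̂`. -/
def topHat (P : Type) : Phat P := ((⊤ : WithTop P) : WithBot (WithTop P))

variable {P : Type} [Fintype P] [PartialOrder P]

/-- `∑_{y ⋖ x} π(y)`. -/
def covSumBelow (π : Phat P → ℝ) (x : Phat P) : ℝ :=
  ∑ y : Phat P, if y ⋖ x then π y else 0

/-- `∑_{x ⋖ y} 1/π(y)`. -/
def covSumAboveInv (π : Phat P → ℝ) (x : Phat P) : ℝ :=
  ∑ y : Phat P, if x ⋖ y then (π y)⁻¹ else 0

/-- The birational order-filter rank toggle `𝐭_i`, in simultaneous form (it agrees with the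
composition of the pairwise commuting birational order filter toggles `t_p` over `p ∈ P_i`,
since a toggle `t_p` only changes the value at `p` and only reads values at `p` and at
elements covering or covered by `p`, which have different ranks). -/
def rankToggleB (rk : P → ℕ) (i : ℕ) (π : Phat P → ℝ) : Phat P → ℝ :=
  fun x =>
    if ∃ p : P, rk p = i ∧ x = emb p then
      covSumBelow π x / (π x * covSumAboveInv π x)
    else π x

/-- Apply a word of rank toggles; the head of the list is applied last, matching the
convention that in a product `𝐭_{i_1} 𝐭_{i_2} ⋯ 𝐭_{i_k}` the rightmost factor acts first. -/
def applyB (rk : P → ℕ) : List ℕ → (Phat P → ℝ) → Phat P → ℝ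
  | [] => fun π => π
  | i :: w => fun π => rankToggleB rk i (applyB rk w π)

/-- The word `𝐭_0 𝐭_1 ⋯ 𝐭_r` for rowmotion. -/
def rowWordB (r : ℕ) : List ℕ := List.range (r + 1)

/-- The word `(𝐭_r)(𝐭_{r-1} 𝐭_r) ⋯ (𝐭_0 𝐭_1 ⋯ 𝐭_r)` for rowvacuation. -/
def rvacWordB (r : ℕ) : List ℕ :=
  (List.range (r + 1)).foldr (fun k acc => (List.range (r + 1)).drop (r - k) ++ acc) []

/-- The word `(𝐭_0)(𝐭_1 𝐭_0) ⋯ (𝐭_r 𝐭_{r-1} ⋯ 𝐭_0)` for dual rowvacuation. -/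
def drvacWordB (r : ℕ) : List ℕ :=
  (List.range (r + 1)).foldr (fun k acc => (List.range (k + 1)).reverse ++ acc) []

/-- Birational order filter rowmotion `Row^B_F = 𝐭_0 𝐭_1 ⋯ 𝐭_r`. -/
def RowB (rk : P → ℕ) (r : ℕ) : (Phat P → ℝ) → Phat P → ℝ := applyB rk (rowWordB r)

/-- The inverse of birational order filter rowmotion, `(Row^B_F)⁻¹ = 𝐭_r ⋯ 𝐭_1 𝐭_0`
(each toggle is an involution, so the reversed word gives the inverse map). -/
def RowInvB (rk : P → ℕ) (r : ℕ) : (Phat P → ℝ) → Phat P → ℝ := applyB rk (rowWordB r).reverse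

/-- Birational order filter rowvacuation `Rvac^B_F`. -/
def RvacB (rk : P → ℕ) (r : ℕ) : (Phat P → ℝ) → Phat P → ℝ := applyB rk (rvacWordB r)

/-- Birational order filter dual rowvacuation `DRvac^B_F`. -/
def DRvacB (rk : P → ℕ) (r : ℕ) : (Phat P → ℝ) → Phat P → ℝ := applyB rk (drvacWordB r)

end

/-- The underlying set of the poset `Aⁿ`: pairs `(i,j)` with `1 ≤ i ≤ j ≤ n`,
representing the intervals `[i,j] ⊆ [n]`. -/
def AnP (n : ℕ) : Type := {p : ℕ × ℕ // 1 ≤ p.1 ∧ p.1 ≤ p.2 ∧ p.2 ≤ n}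

/-- `Aⁿ` is ordered by containment of intervals. -/
instance (n : ℕ) : PartialOrder (AnP n) where
  le x y := y.val.1 ≤ x.val.1 ∧ x.val.2 ≤ y.val.2
  le_refl x := ⟨le_refl _, le_refl _⟩
  le_trans x y z h1 h2 := ⟨le_trans h2.1 h1.1, le_trans h1.2 h2.2⟩
  le_antisymm x y h1 h2 :=
    Subtype.ext (Prod.ext_iff.mpr ⟨le_antisymm h2.1 h1.1, le_antisymm h1.2 h2.2⟩)

instance (n : ℕ) : Fintype (AnP n) :=
  Fintype.subtype
    ((Finset.Icc 1 n ×ˢ Finset.Icc 1 n).filter (fun p => 1 ≤ p.1 ∧ p.1 ≤ p.2 ∧ p.2 ≤ n))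
    (by
      intro x
      simp only [Finset.mem_filter, Finset.mem_product, Finset.mem_Icc]
      omega)

/-- The rank function of `Aⁿ`: `rk [i,j] = j - i`; `Aⁿ` is graded of rank `n - 1`. -/
def rkAn (n : ℕ) : AnP n → ℕ := fun p => p.val.2 - p.val.1

noncomputable section

/-- The poset automorphism `Flip` of `Aⁿ`, `[i,j] ↦ [n+1-j, n+1-i]`
(the reflection of `Aⁿ` across its vertical axis of symmetry). -/
def flipAn (n : ℕ) (p : AnP n) : AnP n :=
  ⟨(n + 1 - p.val.2, n + 1 - p.val.1), by
    have h := p.2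
    show 1 ≤ n + 1 - p.val.2 ∧ n + 1 - p.val.2 ≤ n + 1 - p.val.1 ∧ n + 1 - p.val.1 ≤ n
    omega⟩

end

/-- A positive orbit of birational rowmotion on the `p × q` rectangle, with time as first
argument. The labels are padded by zeros around the rectangle `[1,p] × [1,q]`, except that the
label `a` of the minimum sits at `(1,0)` and the label `b` of the maximum at `(p+1,q)`. -/
structure IsRectOrbit (p q : ℕ) (a b : ℝ) (x : ℕ → ℕ → ℕ → ℝ) : Prop where
  a_pos : 0 < a
  b_pos : 0 < b
  q_pos : 0 < q
  pos : ∀ t i j, i < p → j < q → 0 < x t (i + 1) (j + 1)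
  left : ∀ t j, x t 0 j = 0
  bot : ∀ t, x t 1 0 = a
  below : ∀ t i, x t (i + 2) 0 = 0
  top : ∀ t, x t (p + 1) q = b
  right : ∀ t j, j ≠ q → x t (p + 1) j = 0
  above : ∀ t i j, q < j → x t i j = 0
  row : ∀ t i j, i < p → j < q →
    x (t + 1) (i + 1) (j + 1) * x t (i + 1) (j + 1) *
      ((x (t + 1) (i + 2) (j + 1))⁻¹ + (x (t + 1) (i + 1) (j + 2))⁻¹) =
    x t i (j + 1) + x t (i + 1) j

/-- The quotient of a label by the sum of the labels it covers, extended by zero. -/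
noncomputable def downSlack (p q : ℕ) (y : ℕ → ℕ → ℝ) (i j : ℕ) : ℝ :=
  if 1 ≤ i ∧ i ≤ p ∧ 1 ≤ j ∧ j ≤ q then y i j / (y (i - 1) j + y i (j - 1)) else 0

/-- The weighted number of lattice paths with `m` steps from `(i,j)` to `(k,l)`. -/
noncomputable def pathSum (w : ℕ → ℕ → ℝ) (k l : ℕ) : ℕ → ℕ → ℕ → ℝ
  | 0, i, j => if i = k ∧ j = l then w i j else 0
  | m + 1, i, j => w i j * (pathSum w k l m (i + 1) j + pathSum w k l m i (j + 1))

/-- The sum of `F` over the points `(i+1,j), (i+2,j-1), …` of an antidiagonal. -/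
def antidiagSum (F : ℕ → ℕ → ℝ) : ℕ → ℕ → ℝ
  | _, 0 => 0
  | i, j + 1 => F (i + 1) (j + 1) + antidiagSum F (i + 1) j

lemma pathSum_eq_zero {w : ℕ → ℕ → ℝ} {i j : ℕ} (h : w i j = 0) (k l m : ℕ) :
    pathSum w k l m i j = 0 := by
  cases m <;> simp [pathSum, h]

lemma pathSum_end_eq_zero {w : ℕ → ℕ → ℝ} {k l : ℕ} (h : w k l = 0) (m i j : ℕ) :
    pathSum w k l m i j = 0 := by
  induction m generalizing i j with
  | zero =>
    simp only [pathSum]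
    split_ifs with h'
    · rw [h'.1, h'.2, h]
    · rfl
  | succ m ih => simp [pathSum, ih]

lemma pathSum_succ_end (w : ℕ → ℕ → ℝ) (k l m i j : ℕ) :
    pathSum w (k + 1) (l + 1) (m + 1) i j =
      w (k + 1) (l + 1) * (pathSum w k (l + 1) m i j + pathSum w (k + 1) l m i j) := by
  induction m generalizing i j with
  | zero =>
    simp only [pathSum]
    by_cases h1 : i = k ∧ j = l + 1
    · obtain ⟨rfl, rfl⟩ := h1
      simp; ring
    · by_cases h2 : i = k + 1 ∧ j = l
      · obtain ⟨rfl, rfl⟩ := h2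
        simp; ring
      · rw [if_neg (by omega), if_neg (by omega), if_neg h1, if_neg h2]
        ring
  | succ m ih =>
    rw [pathSum, ih, ih, pathSum, pathSum]
    ring

lemma downSlack_of_lt (p q : ℕ) (y : ℕ → ℕ → ℝ) (i j : ℕ) (h : p < i ∨ q < j) :
    downSlack p q y i j = 0 := if_neg (by omega)

lemma antidiagSum_succ (F : ℕ → ℕ → ℝ) (i j : ℕ) :
    antidiagSum F i (j + 1) = F (i + 1) (j + 1) + antidiagSum F (i + 1) j := rfl

/-- The sum of the path sums ending at `(k,q)`, weighted by down slacks, with the first weight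
replaced by the corresponding label. -/
noncomputable def slackPathSum (p q : ℕ) (y : ℕ → ℕ → ℝ) (k m i j : ℕ) : ℝ :=
  (y (i - 1) j + y i (j - 1)) * pathSum (downSlack p q y) k q m i j

lemma slackPathSum_succ (p q : ℕ) (y : ℕ → ℕ → ℝ) (k m i j : ℕ) :
    slackPathSum p q y k m (i + 1) (j + 1) =
      (y i (j + 1) + y (i + 1) j) * pathSum (downSlack p q y) k q m (i + 1) (j + 1) := rfl

lemma antidiagSum_slackPathSum_eq_zero (p q : ℕ) (y : ℕ → ℕ → ℝ) (k m i j : ℕ) (hi : p ≤ i) :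
    antidiagSum (slackPathSum p q y k m) i j = 0 := by
  induction j generalizing i with
  | zero => rfl
  | succ j ih =>
    rw [antidiagSum, slackPathSum, pathSum_eq_zero (downSlack_of_lt p q y _ _ (by omega)),
      ih _ (by omega), mul_zero, add_zero]

namespace IsRectOrbit

variable {p q : ℕ} {a b : ℝ} {x : ℕ → ℕ → ℕ → ℝ}

lemma nonneg_bot (h : IsRectOrbit p q a b x) (t i : ℕ) : 0 ≤ x t i 0 := by
  match i with
  | 0 => exact (h.left t 0).ge
  | 1 => rw [h.bot]; exact h.a_pos.le
  | i + 2 => exact (h.below t i).ge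

lemma down_pos (h : IsRectOrbit p q a b x) (t i j : ℕ) (hi : i < p) (hj : j < q) :
    0 < x t i (j + 1) + x t (i + 1) j := by
  cases i with
  | zero =>
    rw [h.left, zero_add]
    cases j with
    | zero => rw [h.bot]; exact h.a_pos
    | succ j => exact h.pos _ _ _ hi (by omega)
  | succ i =>
    refine add_pos_of_pos_of_nonneg (h.pos _ _ _ (by omega) hj) ?_
    cases j with
    | zero => exact h.nonneg_bot _ _
    | succ j => exact (h.pos _ _ _ hi (by omega)).le

lemma downSlack_eq (t i j : ℕ) (hi : i < p) (hj : j < q) :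
    downSlack p q (x t) (i + 1) (j + 1) =
      x t (i + 1) (j + 1) / (x t i (j + 1) + x t (i + 1) j) := by
  rw [downSlack, if_pos (by omega)]
  rfl

lemma eq_downSlack_mul (h : IsRectOrbit p q a b x) (t i j : ℕ) (hi : i < p) (hj : j < q) :
    x t (i + 1) (j + 1) =
      downSlack p q (x t) (i + 1) (j + 1) * (x t i (j + 1) + x t (i + 1) j) := by
  rw [downSlack_eq t i j hi hj, div_mul_cancel₀ _ (h.down_pos t i j hi hj).ne']

lemma inv_eq_downSlack_mul (h : IsRectOrbit p q a b x) (t i j : ℕ) (hi : i < p) (hj : j < q) :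
    (x (t + 1) (i + 1) (j + 1))⁻¹ =
      downSlack p q (x t) (i + 1) (j + 1) *
        ((x (t + 1) (i + 2) (j + 1))⁻¹ + (x (t + 1) (i + 1) (j + 2))⁻¹) := by
  have hD := h.down_pos t i j hi hj
  have h1 := h.pos (t + 1) i j hi hj
  have hr := h.row t i j hi hj
  rw [downSlack_eq t i j hi hj, inv_eq_one_div, div_mul_eq_mul_div, div_eq_div_iff h1.ne' hD.ne']
  linarith

lemma eq_mul_pathSum (h : IsRectOrbit p q a b x) (t m i j : ℕ) (hi : i < p) (hj : j < q)
    (hm : i + j = m) :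
    x t (i + 1) (j + 1) = a * pathSum (downSlack p q (x t)) (i + 1) (j + 1) m 1 1 := by
  induction m generalizing i j with
  | zero =>
    obtain ⟨rfl, rfl⟩ : i = 0 ∧ j = 0 := by omega
    rw [h.eq_downSlack_mul t 0 0 hi hj, h.left, zero_add, h.bot]
    simp [pathSum, mul_comm]
  | succ m ih =>
    rw [pathSum_succ_end, h.eq_downSlack_mul t i j hi hj]
    have h1 : x t i (j + 1) = a * pathSum (downSlack p q (x t)) i (j + 1) m 1 1 := by
      cases i with
      | zero => rw [h.left, pathSum_end_eq_zero (if_neg (by omega)), mul_zero]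
      | succ i => exact ih i j (by omega) hj (by omega)
    have h2 : x t (i + 1) j = a * pathSum (downSlack p q (x t)) (i + 1) j m 1 1 := by
      cases j with
      | zero =>
        obtain ⟨i, rfl⟩ : ∃ i', i = i' + 1 := ⟨i - 1, by omega⟩
        rw [h.below, pathSum_end_eq_zero (if_neg (by omega)), mul_zero]
      | succ j => exact ih i j hi (by omega) (by omega)
    rw [h1, h2]
    ring

lemma mul_inv_eq_pathSum (h : IsRectOrbit p q a b x) (t m i j : ℕ) (hi : i < p) (hj : j < q)
    (hm : i + j + m + 2 = p + q) :
    b * (x (t + 1) (i + 1) (j + 1))⁻¹ = pathSum (downSlack p q (x t)) p q m (i + 1) (j + 1) := by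
  induction m generalizing i j with
  | zero =>
    obtain ⟨rfl, rfl⟩ : p = i + 1 ∧ q = j + 1 := by omega
    rw [h.inv_eq_downSlack_mul t i j hi hj, h.top, h.above _ _ _ (by omega)]
    have := h.b_pos.ne'
    simp only [pathSum, and_self, if_true]
    field_simp
    simp
  | succ m ih =>
    rw [pathSum, h.inv_eq_downSlack_mul t i j hi hj]
    have h1 : b * (x (t + 1) (i + 2) (j + 1))⁻¹ =
        pathSum (downSlack p q (x t)) p q m (i + 2) (j + 1) := by
      by_cases hi' : i + 1 < p
      · exact ih (i + 1) j hi' hj (by omega)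
      · obtain rfl : p = i + 1 := by omega
        rw [h.right _ _ (by omega), pathSum_eq_zero (if_neg (by omega)), inv_zero, mul_zero]
    have h2 : b * (x (t + 1) (i + 1) (j + 2))⁻¹ =
        pathSum (downSlack p q (x t)) p q m (i + 1) (j + 2) := by
      by_cases hj' : j + 1 < q
      · exact ih i (j + 1) hi hj' (by omega)
      · rw [h.above _ _ _ (by omega), pathSum_eq_zero (if_neg (by omega)), inv_zero, mul_zero]
    rw [← h1, ← h2]
    ring

/-- The intertwining relation between path sums with respect to the slacks at consecutive
times. -/
lemma pathSum_eq_antidiagSum (h : IsRectOrbit p q a b x) (t k : ℕ) (hk : k < p) (m i j : ℕ) :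
    pathSum (downSlack p q (x t)) k q m (i + 1) (j + 1) =
      (x (t + 1) (i + 1) (j + 1))⁻¹ *
        antidiagSum (slackPathSum p q (x (t + 1)) (k + 1) m) (i + 1) (j + 1) := by
  have off : ∀ m i j, p < i ∨ q < j →
      pathSum (downSlack p q (x (t + 1))) (k + 1) q m i j = 0 := fun m i j hij =>
    pathSum_eq_zero (downSlack_of_lt p q _ i j hij) _ _ _
  have outside : ∀ m i j, ¬(i < p ∧ j < q) →
      pathSum (downSlack p q (x t)) k q m (i + 1) (j + 1) =
      (x (t + 1) (i + 1) (j + 1))⁻¹ *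
        antidiagSum (slackPathSum p q (x (t + 1)) (k + 1) m) (i + 1) (j + 1) := by
    intro m i j hij
    rw [pathSum_eq_zero (downSlack_of_lt p q _ _ _ (by omega))]
    by_cases hj : j < q
    · rw [antidiagSum_slackPathSum_eq_zero _ _ _ _ _ _ _ (by omega), mul_zero]
    · rw [h.above _ _ _ (by omega), inv_zero, zero_mul]
  induction m generalizing i j with
  | zero =>
    by_cases hij : i < p ∧ j < q
    swap
    · exact outside 0 i j hij
    obtain ⟨hi, hj⟩ := hij
    have key : ∀ i j, j ≤ q → antidiagSum (slackPathSum p q (x (t + 1)) (k + 1) 0) i j =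
        if i = k ∧ j = q then x (t + 1) (k + 1) q else 0 := by
      intro i j hj
      induction j generalizing i with
      | zero => rw [antidiagSum, if_neg (by have := h.q_pos; omega)]
      | succ j ih =>
        rw [antidiagSum, ih _ (by omega), if_neg (by omega), add_zero]
        simp only [slackPathSum, pathSum, Nat.add_right_cancel_iff]
        split_ifs with hc
        · obtain ⟨rfl, rfl⟩ := hc
          rw [h.eq_downSlack_mul (t + 1) i j hk (by omega)]
          simp [mul_comm]
        · rw [mul_zero]
    rw [key _ _ (by omega)]
    simp only [pathSum]
    split_ifs with hc
    · obtain ⟨rfl, rfl⟩ := hc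
      rw [h.inv_eq_downSlack_mul t i j hi hj, h.above _ _ (j + 2) (by omega), inv_zero, add_zero,
        mul_assoc, inv_mul_cancel₀ (h.pos _ _ _ hk hj).ne', mul_one]
    · rw [mul_zero]
  | succ m ih =>
    by_cases hij : i < p ∧ j < q
    swap
    · exact outside _ i j hij
    obtain ⟨hi, hj⟩ := hij
    have hF : ∀ i j, slackPathSum p q (x (t + 1)) (k + 1) (m + 1) (i + 1) (j + 1) =
        x (t + 1) (i + 1) (j + 1) *
          (pathSum (downSlack p q (x (t + 1))) (k + 1) q m (i + 2) (j + 1) +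
            pathSum (downSlack p q (x (t + 1))) (k + 1) q m (i + 1) (j + 2)) := by
      intro i j
      rw [slackPathSum_succ]
      by_cases hgrid : i < p ∧ j < q
      · rw [h.eq_downSlack_mul (t + 1) i j hgrid.1 hgrid.2, pathSum]
        ring
      · rw [off _ _ _ (by omega), off _ _ _ (by omega), off _ _ _ (by omega)]
        ring
    have key : ∀ i j, antidiagSum (slackPathSum p q (x (t + 1)) (k + 1) (m + 1)) (i + 1) j =
        antidiagSum (slackPathSum p q (x (t + 1)) (k + 1) m) (i + 2) j +
        x (t + 1) (i + 2) j *
          pathSum (downSlack p q (x (t + 1))) (k + 1) q m (i + 2) (j + 1) := by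
      intro i j
      induction j generalizing i with
      | zero => simp [antidiagSum, h.below]
      | succ j ih =>
        rw [antidiagSum, ih, antidiagSum, hF, slackPathSum_succ]
        ring
    rw [pathSum, ih (i + 1) j, ih i (j + 1), key, antidiagSum_succ _ (i + 1) (j + 1),
      slackPathSum_succ, h.inv_eq_downSlack_mul t i j hi hj]
    by_cases hgrid : i + 1 < p ∧ j + 1 < q
    · have h1 := (h.pos (t + 1) (i + 1) j hgrid.1 hj).ne'
      have h2 := (h.pos (t + 1) i (j + 1) hi hgrid.2).ne'
      field_simp
      ring
    · rw [off m (i + 1 + 1) (j + 1 + 1) (by omega)]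
      ring

lemma pathSum_translate (h : IsRectOrbit p q a b x) (t k m i : ℕ) (hk : k < p) :
    pathSum (downSlack p q (x t)) k q m (i + 1) 1 =
      pathSum (downSlack p q (x (t + 1))) (k + 1) q m (i + 2) 1 := by
  rw [h.pathSum_eq_antidiagSum t k hk m i 0]
  by_cases hi : i < p
  · rw [antidiagSum, antidiagSum, add_zero, slackPathSum_succ, h.below, add_zero, ← mul_assoc,
      inv_mul_cancel₀ (h.pos (t + 1) i 0 hi h.q_pos).ne', one_mul]
  · rw [antidiagSum_slackPathSum_eq_zero _ _ _ _ _ _ _ (by omega), mul_zero,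
      pathSum_eq_zero (downSlack_of_lt p q _ _ _ (by omega))]

lemma pathSum_translate_iterate (h : IsRectOrbit p q a b x) (t k m s : ℕ) (hk : k + s ≤ p) :
    pathSum (downSlack p q (x t)) k q m 1 1 =
      pathSum (downSlack p q (x (t + s))) (k + s) q m (s + 1) 1 := by
  induction s with
  | zero => rfl
  | succ s ih => rw [ih (by omega), h.pathSum_translate _ _ _ _ (by omega)]; rfl

lemma reciprocity_edge (h : IsRectOrbit p q a b x) (t k s : ℕ) (hk : k + 1 + s = p) :
    x t (k + 1) q * x (t + s + 1) (s + 1) 1 = a * b := by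
  obtain ⟨r, rfl⟩ : ∃ r, q = r + 1 := ⟨q - 1, by have := h.q_pos; omega⟩
  have hx := (h.pos (t + s + 1) s 0 (by omega) h.q_pos).ne'
  rw [h.eq_mul_pathSum t (k + r) k r (by omega) (by omega) rfl,
    h.pathSum_translate_iterate t (k + 1) _ s (by omega), hk,
    ← h.mul_inv_eq_pathSum (t + s) (k + r) s 0 (by omega) h.q_pos (by omega)]
  rw [zero_add] at hx ⊢
  field_simp

/-- Antipodal reciprocity for birational rowmotion on a rectangle. -/
theorem reciprocity (h : IsRectOrbit p q a b x) (t i j k l : ℕ) (hi : i + (k + 1) = p)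
    (hj : j + (l + 1) = q) :
    x t (k + 1) (l + 1) * x (t + i + j + 1) (i + 1) (j + 1) = a * b := by
  induction j using Nat.strong_induction_on generalizing t i k l with
  | _ j ih =>
  cases j with
  | zero =>
    obtain rfl : q = l + 1 := by omega
    exact h.reciprocity_edge t k i (by omega)
  | succ j =>
    have ha := h.a_pos
    have hb := h.b_pos
    set T := t + i + j + 1 with hT
    have r1 := h.row T i j (by omega) (by omega)
    have r2 := h.row t k (l + 1) (by omega) (by omega)
    have e1 := ih j (by omega) t i k (l + 1) hi (by omega)
    have e2 := ih j (by omega) (t + 1) i k (l + 1) hi (by omega)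
    rw [show t + 1 + i + j + 1 = T + 1 by omega] at e2
    have e3 : a * b * (x (T + 1) (i + 2) (j + 1))⁻¹ = x t k (l + 2) := by
      cases k with
      | zero =>
        obtain rfl : p = i + 1 := by omega
        rw [h.left, h.right _ _ (by omega), inv_zero, mul_zero]
      | succ k =>
        have := ih j (by omega) t (i + 1) k (l + 1) (by omega) (by omega)
        rw [show t + (i + 1) + j + 1 = T + 1 by omega] at this
        have hp := (h.pos (T + 1) (i + 1) j (by omega) (by omega)).ne'
        rw [← this]
        field_simp
    have e4 : x T i (j + 1) + x T (i + 1) j =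
        a * b * ((x (t + 1) (k + 2) (l + 2))⁻¹ + (x (t + 1) (k + 1) (l + 3))⁻¹) := by
      rw [mul_add]
      have f1 : i + j ≠ 0 → x T i (j + 1) = a * b * (x (t + 1) (k + 2) (l + 2))⁻¹ := by
        intro hij
        cases i with
        | zero =>
          obtain rfl : p = k + 1 := by omega
          rw [h.left, h.right _ _ (by omega), inv_zero, mul_zero]
        | succ i =>
          have := ih j (by omega) (t + 1) i (k + 1) (l + 1) (by omega) (by omega)
          rw [show t + 1 + i + j + 1 = T by omega] at this
          have hp := (h.pos (t + 1) (k + 1) (l + 1) (by omega) (by omega)).ne'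
          rw [← this]
          field_simp
      have f2 : i + j ≠ 0 → x T (i + 1) j = a * b * (x (t + 1) (k + 1) (l + 3))⁻¹ := by
        intro hij
        cases j with
        | zero =>
          obtain ⟨i, rfl⟩ : ∃ i', i = i' + 1 := ⟨i - 1, by omega⟩
          rw [h.below, h.above _ _ _ (by omega), inv_zero, mul_zero]
        | succ j =>
          have := ih j (by omega) (t + 1) i k (l + 2) (by omega) (by omega)
          rw [show t + 1 + i + j + 1 = T by omega] at this
          have hp := (h.pos (t + 1) k (l + 2) (by omega) (by omega)).ne'
          rw [← this]
          field_simp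
      by_cases hij : i + j = 0
      · obtain ⟨rfl, rfl⟩ : i = 0 ∧ j = 0 := by omega
        obtain ⟨rfl, rfl⟩ : p = k + 1 ∧ q = l + 2 := by omega
        rw [h.left, h.bot, h.top, h.above _ _ (l + 3) (by omega)]
        field_simp
        simp
      · rw [f1 hij, f2 hij]
    have p3 := h.pos (T + 1) i (j + 1) (by omega) (by omega)
    have e5 : a * b * (x (T + 1) (i + 1) (j + 2))⁻¹ = x t (k + 1) (l + 1) := by
      rw [e4] at r1
      apply mul_left_cancel₀ (mul_pos ha hb).ne'
      linear_combination (x t (k + 1) (l + 2) * x (t + 1) (k + 1) (l + 2)) * r1 +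
        (a * b) * r2 - (a * b) * e3 - ((x (T + 1) (i + 2) (j + 1))⁻¹ +
          (x (T + 1) (i + 1) (j + 2))⁻¹) * (x (t + 1) (k + 1) (l + 2) * x (T + 1) (i + 1) (j + 1) * e1
           + a * b * e2)
    rw [show t + i + (j + 1) + 1 = T + 1 by omega, ← e5, mul_assoc, inv_mul_cancel₀ p3.ne', mul_one]

end IsRectOrbit

section Poset

variable {P : Type}

lemma emb_injective : Function.Injective (emb (P := P)) :=
  WithBot.coe_injective.comp WithTop.coe_injective

lemma emb_ne_bot (v : P) : emb v ≠ ⊥ := WithBot.coe_ne_bot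

lemma emb_ne_topHat (v : P) : emb v ≠ topHat P := fun h =>
  WithTop.coe_ne_top (WithBot.coe_injective h)

lemma Phat.cases (y : Phat P) : y = ⊥ ∨ y = topHat P ∨ ∃ w, y = emb w := by
  induction y using WithBot.recBotCoe with
  | bot => exact .inl rfl
  | coe y =>
    induction y using WithTop.recTopCoe with
    | top => exact .inr (.inl rfl)
    | coe y => exact .inr (.inr ⟨y, rfl⟩)

variable [PartialOrder P]

lemma emb_covBy_emb {v w : P} : emb v ⋖ emb w ↔ v ⋖ w := by
  rw [emb, emb, WithBot.coe_covBy_coe, WithTop.coe_covBy_coe]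

lemma bot_covBy_emb {v : P} : ⊥ ⋖ emb v ↔ IsMin v := by
  rw [emb, WithBot.bot_covBy_coe]
  refine ⟨fun h w hw => WithTop.coe_le_coe.1 (h (WithTop.coe_le_coe.2 hw)), fun h w hw => ?_⟩
  lift w to P using ne_top_of_le_ne_top WithTop.coe_ne_top hw
  exact WithTop.coe_le_coe.2 (h (WithTop.coe_le_coe.1 hw))

lemma emb_covBy_topHat {v : P} : emb v ⋖ topHat P ↔ IsMax v := by
  rw [emb, topHat, WithBot.coe_covBy_coe, WithTop.coe_covBy_top]

lemma not_topHat_covBy (y : Phat P) : ¬ topHat P ⋖ y := fun h => by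
  have : (⊤ : Phat P) < y := h.lt
  exact not_top_lt this

variable [Fintype P]

lemma applyB_cons (rk : P → ℕ) (i : ℕ) (w : List ℕ) (σ : Phat P → ℝ) :
    applyB rk (i :: w) σ = rankToggleB rk i (applyB rk w σ) := rfl

lemma rankToggleB_of_ne {rk : P → ℕ} {i : ℕ} {x : Phat P} (h : ∀ v, x = emb v → rk v ≠ i)
    (σ : Phat P → ℝ) : rankToggleB rk i σ x = σ x :=
  if_neg fun ⟨v, hv, hx⟩ => h v hx hv

lemma rankToggleB_emb (rk : P → ℕ) (v : P) (σ : Phat P → ℝ) :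
    rankToggleB rk (rk v) σ (emb v) =
      covSumBelow σ (emb v) / (σ (emb v) * covSumAboveInv σ (emb v)) :=
  if_pos ⟨v, rfl, rfl⟩

lemma applyB_range'_of_ne {rk : P → ℕ} {x : Phat P} (k m : ℕ)
    (h : ∀ v, x = emb v → rk v < k ∨ k + m ≤ rk v) (σ : Phat P → ℝ) :
    applyB rk (List.range' k m) σ x = σ x := by
  induction m generalizing k with
  | zero => rfl
  | succ m ih =>
    rw [List.range'_succ, applyB_cons, rankToggleB_of_ne fun v hv => by have := h v hv; omega]
    exact ih _ fun v hv => by have := h v hv; omega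

lemma applyB_range'_append (rk : P → ℕ) (v : P) (k m l : ℕ) (hv : k + m ≤ rk v)
    (σ : Phat P → ℝ) :
    applyB rk (List.range' k (m + l)) σ (emb v) =
      applyB rk (List.range' (k + m) l) σ (emb v) := by
  induction m generalizing k with
  | zero => rw [zero_add, add_zero]
  | succ m ih =>
    rw [show m + 1 + l = (m + l) + 1 by omega, List.range'_succ, applyB_cons,
      rankToggleB_of_ne fun w hw => ?_]
    · rw [show k + (m + 1) = k + 1 + m by omega]
      exact ih _ (by omega)
    · rw [← emb_injective hw]
      omega

lemma covSumBelow_congr {σ τ : Phat P → ℝ} {x : Phat P} (h : ∀ y, y ⋖ x → σ y = τ y) :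
    covSumBelow σ x = covSumBelow τ x :=
  Finset.sum_congr rfl fun y _ => by
    split_ifs with hy
    · exact h y hy
    · rfl

lemma covSumAboveInv_congr {σ τ : Phat P → ℝ} {x : Phat P} (h : ∀ y, x ⋖ y → σ y = τ y) :
    covSumAboveInv σ x = covSumAboveInv τ x :=
  Finset.sum_congr rfl fun y _ => by
    split_ifs with hy
    · rw [h y hy]
    · rfl

lemma RowB_bot (rk : P → ℕ) (r : ℕ) (σ : Phat P → ℝ) : RowB rk r σ ⊥ = σ ⊥ := by
  rw [RowB, rowWordB, List.range_eq_range']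
  exact applyB_range'_of_ne _ _ (fun v hv => absurd hv.symm (emb_ne_bot v)) _

lemma RowB_topHat (rk : P → ℕ) (r : ℕ) (σ : Phat P → ℝ) :
    RowB rk r σ (topHat P) = σ (topHat P) := by
  rw [RowB, rowWordB, List.range_eq_range']
  exact applyB_range'_of_ne _ _ (fun v hv => absurd hv.symm (emb_ne_topHat v)) _

/-- The recursive description of rowmotion, from the top of the poset to the bottom. -/
lemma RowB_emb {rk : P → ℕ} {r : ℕ} (hrk : StrictMono rk) (hr : ∀ v, rk v ≤ r)
    (σ : Phat P → ℝ) (v : P) :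
    RowB rk r σ (emb v) =
      covSumBelow σ (emb v) / (σ (emb v) * covSumAboveInv (RowB rk r σ) (emb v)) := by
  have hv := hr v
  have key : ∀ w, rk v ≤ rk w → RowB rk r σ (emb w) =
      applyB rk (List.range' (rk v) (r + 1 - rk v)) σ (emb w) := fun w hw => by
    rw [RowB, rowWordB, List.range_eq_range',
      show r + 1 = rk v + (r + 1 - rk v) by omega, applyB_range'_append _ _ _ _ _ (by omega)]
    simp
  rw [key v le_rfl, show r + 1 - rk v = (r - rk v) + 1 by omega, List.range'_succ, applyB_cons,
    rankToggleB_emb]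
  have hσ : ∀ x, (∀ w, x = emb w → rk w ≤ rk v) →
      applyB rk (List.range' (rk v + 1) (r - rk v)) σ x = σ x := fun x hx =>
    applyB_range'_of_ne _ _ (fun w hw => .inl (by have := hx w hw; omega)) _
  congr 1
  · refine covSumBelow_congr fun y hy => hσ y fun w hw => ?_
    rw [hw, emb_covBy_emb] at hy
    exact (hrk hy.lt).le
  · congr 1
    · exact hσ _ fun w hw => by rw [emb_injective hw]
    · refine covSumAboveInv_congr fun y hy => ?_
      rcases Phat.cases y with rfl | rfl | ⟨w, rfl⟩
      · exact absurd hy not_covBy_bot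
      · rw [RowB_topHat]
        exact hσ _ fun w hw => absurd hw.symm (emb_ne_topHat w)
      · have hw := hrk (emb_covBy_emb.1 hy).lt
        rw [key w hw.le, show r + 1 - rk v = 1 + (r - rk v) by omega,
          applyB_range'_append _ _ _ _ _ hw]

lemma rankToggleB_pos {rk : P → ℕ} {i : ℕ} {σ : Phat P → ℝ} (hσ : ∀ x, 0 < σ x)
    (hb : ∀ v, 0 < covSumBelow σ (emb v)) (ha : ∀ v, 0 < covSumAboveInv σ (emb v))
    (x : Phat P) : 0 < rankToggleB rk i σ x := by
  unfold rankToggleB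
  split_ifs with h
  · obtain ⟨v, -, rfl⟩ := h
    exact div_pos (hb v) (mul_pos (hσ _) (ha v))
  · exact hσ x

lemma applyB_pos {rk : P → ℕ}
    (hb : ∀ σ : Phat P → ℝ, (∀ x, 0 < σ x) → ∀ v, 0 < covSumBelow σ (emb v))
    (ha : ∀ σ : Phat P → ℝ, (∀ x, 0 < σ x) → ∀ v, 0 < covSumAboveInv σ (emb v))
    (l : List ℕ) {σ : Phat P → ℝ} (hσ : ∀ x, 0 < σ x) (x : Phat P) : 0 < applyB rk l σ x := by
  induction l generalizing x with
  | nil => exact hσ x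
  | cons i l ih => exact rankToggleB_pos ih (hb _ ih) (ha _ ih) x

end Poset

section Interval

variable {n : ℕ}

lemma AnP.eq_iff {v w : AnP n} : v = w ↔ v.val.1 = w.val.1 ∧ v.val.2 = w.val.2 :=
  Subtype.ext_iff.trans Prod.ext_iff

lemma AnP.lt_iff {v w : AnP n} :
    v < w ↔ w.val.1 ≤ v.val.1 ∧ v.val.2 ≤ w.val.2 ∧ (w.val.1 ≠ v.val.1 ∨ w.val.2 ≠ v.val.2) := by
  rw [lt_iff_le_not_ge]
  show (w.val.1 ≤ v.val.1 ∧ v.val.2 ≤ w.val.2) ∧ ¬(v.val.1 ≤ w.val.1 ∧ w.val.2 ≤ v.val.2) ↔ _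
  omega

lemma AnP.covBy_iff {v w : AnP n} :
    v ⋖ w ↔ (v.val.1 = w.val.1 + 1 ∧ v.val.2 = w.val.2) ∨
      (v.val.1 = w.val.1 ∧ v.val.2 + 1 = w.val.2) := by
  have hv := v.2
  have hw := w.2
  constructor
  · rintro ⟨h, h'⟩
    rw [AnP.lt_iff] at h
    by_contra hc
    by_cases h1 : w.val.1 < v.val.1
    · refine @h' ⟨(w.val.1 + 1, w.val.2), by dsimp only; omega⟩ (AnP.lt_iff.2 ?_) (AnP.lt_iff.2 ?_) <;>
        dsimp only <;> omega
    · refine @h' ⟨(w.val.1, w.val.2 - 1), by dsimp only; omega⟩ (AnP.lt_iff.2 ?_) (AnP.lt_iff.2 ?_) <;>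
        dsimp only <;> omega
  · intro h
    refine ⟨AnP.lt_iff.2 (by omega), fun u h1 h2 => ?_⟩
    rw [AnP.lt_iff] at h1 h2
    omega

lemma AnP.isMin_iff {v : AnP n} : IsMin v ↔ v.val.1 = v.val.2 := by
  have hv := v.2
  rw [isMin_iff_forall_not_lt]
  constructor
  · intro h
    by_contra hc
    refine h ⟨(v.val.1, v.val.1), by dsimp only; omega⟩ (AnP.lt_iff.2 ?_)
    dsimp only
    omega
  · intro h w hw
    have := w.2
    rw [AnP.lt_iff] at hw
    omega

lemma AnP.isMax_iff {v : AnP n} : IsMax v ↔ v.val.1 = 1 ∧ v.val.2 = n := by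
  have hv := v.2
  rw [isMax_iff_forall_not_lt]
  constructor
  · intro h
    by_contra hc
    refine h ⟨(1, n), by dsimp only; omega⟩ (AnP.lt_iff.2 ?_)
    dsimp only
    omega
  · intro h w hw
    have := w.2
    rw [AnP.lt_iff] at hw
    omega

lemma rkAn_strictMono (n : ℕ) : StrictMono (rkAn n) := fun v w h => by
  have hv := v.2
  have hw := w.2
  rw [AnP.lt_iff] at h
  unfold rkAn
  omega

lemma rkAn_le (v : AnP n) : rkAn n v ≤ n - 1 := by
  have hv := v.2
  unfold rkAn
  omega

/-- The labels of a labelling of `Âⁿ`, indexed by pairs of natural numbers. The label of the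
maximum sits at `(0,n)`, and half of the label of the minimum sits at each empty interval
`[i+1,i]`. -/
noncomputable def intervalLabel (n : ℕ) (σ : Phat (AnP n) → ℝ) (i j : ℕ) : ℝ :=
  if h : 1 ≤ i ∧ i ≤ j ∧ j ≤ n then σ (emb ⟨(i, j), h⟩)
  else if i = 0 ∧ j = n then σ (topHat (AnP n))
  else if 1 ≤ i ∧ i = j + 1 ∧ j ≤ n then σ ⊥ / 2
  else 0

lemma intervalLabel_val (σ : Phat (AnP n) → ℝ) (v : AnP n) :
    intervalLabel n σ v.val.1 v.val.2 = σ (emb v) := dif_pos v.2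

lemma intervalLabel_empty (σ : Phat (AnP n) → ℝ) (j : ℕ) (hj : j ≤ n) :
    intervalLabel n σ (j + 1) j = σ ⊥ / 2 := by
  rw [intervalLabel, dif_neg (by omega), if_neg (by omega), if_pos (by omega)]

lemma intervalLabel_zero (σ : Phat (AnP n) → ℝ) :
    intervalLabel n σ 0 n = σ (topHat (AnP n)) := by
  rw [intervalLabel, dif_neg (by omega), if_pos (by omega)]

lemma intervalLabel_eq_zero (σ : Phat (AnP n) → ℝ) {i j : ℕ}
    (h : n < j ∨ j + 1 < i ∨ i = 0 ∧ j ≠ n) : intervalLabel n σ i j = 0 := by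
  rw [intervalLabel, dif_neg (by omega), if_neg (by omega), if_neg (by omega)]

lemma intervalLabel_pos {σ : Phat (AnP n) → ℝ} (hσ : ∀ x, 0 < σ x) {i j : ℕ} (hi : 1 ≤ i)
    (hij : i ≤ j + 1) (hj : j ≤ n) : 0 < intervalLabel n σ i j := by
  by_cases h : i ≤ j
  · rw [intervalLabel, dif_pos ⟨hi, h, hj⟩]
    exact hσ _
  · obtain rfl : i = j + 1 := by omega
    rw [intervalLabel_empty _ _ hj]
    exact half_pos (hσ _)

lemma covSumBelow_emb (σ : Phat (AnP n) → ℝ) (v : AnP n) :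
    covSumBelow σ (emb v) =
      intervalLabel n σ (v.val.1 + 1) v.val.2 + intervalLabel n σ v.val.1 (v.val.2 - 1) := by
  have hv := v.2
  rw [covSumBelow, ← Finset.sum_filter]
  by_cases h : v.val.1 = v.val.2
  · have hs : Finset.univ.filter (· ⋖ emb v) = {⊥} := by
      ext y
      rw [Finset.mem_filter_univ, Finset.mem_singleton]
      rcases Phat.cases y with rfl | rfl | ⟨w, rfl⟩
      · exact iff_of_true (bot_covBy_emb.2 (AnP.isMin_iff.2 h)) rfl
      · exact iff_of_false (not_topHat_covBy _) (by simp [topHat])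
      · have hw := w.2
        simp only [emb_covBy_emb, AnP.covBy_iff, emb_ne_bot, iff_false]
        omega
    have e : intervalLabel n σ v.val.1 (v.val.2 - 1) = σ ⊥ / 2 := by
      have := intervalLabel_empty σ (v.val.2 - 1) (by omega)
      rwa [show v.val.2 - 1 + 1 = v.val.1 by omega] at this
    rw [hs, Finset.sum_singleton, e, h, intervalLabel_empty _ _ (by omega)]
    ring
  · let w₁ : AnP n := ⟨(v.val.1 + 1, v.val.2), by dsimp only; omega⟩
    let w₂ : AnP n := ⟨(v.val.1, v.val.2 - 1), by dsimp only; omega⟩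
    have hs : Finset.univ.filter (· ⋖ emb v) = {emb w₁, emb w₂} := by
      ext y
      rw [Finset.mem_filter_univ, Finset.mem_insert, Finset.mem_singleton]
      rcases Phat.cases y with rfl | rfl | ⟨w, rfl⟩
      · exact iff_of_false (fun hb => h (AnP.isMin_iff.1 (bot_covBy_emb.1 hb)))
          (by simp [(emb_ne_bot _).symm])
      · simp [not_topHat_covBy, (emb_ne_topHat _).symm]
      · have hw := w.2
        rw [emb_covBy_emb, AnP.covBy_iff, emb_injective.eq_iff, emb_injective.eq_iff,
          AnP.eq_iff, AnP.eq_iff]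
        dsimp only [w₁, w₂]
        omega
    have hne : emb w₁ ≠ emb w₂ := fun he => by
      have := congrArg (fun u : AnP n => u.val.1) (emb_injective he)
      dsimp only [w₁, w₂] at this
      omega
    rw [hs, Finset.sum_pair hne]
    exact congrArg₂ (· + ·) (intervalLabel_val σ w₁).symm (intervalLabel_val σ w₂).symm

lemma covSumAboveInv_emb (σ : Phat (AnP n) → ℝ) (v : AnP n) :
    covSumAboveInv σ (emb v) =
      (intervalLabel n σ (v.val.1 - 1) v.val.2)⁻¹ +
        (intervalLabel n σ v.val.1 (v.val.2 + 1))⁻¹ := by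
  have hv := v.2
  rw [covSumAboveInv, ← Finset.sum_filter]
  by_cases h : v.val.1 = 1 ∧ v.val.2 = n
  · have hs : Finset.univ.filter (emb v ⋖ ·) = {topHat (AnP n)} := by
      ext y
      rw [Finset.mem_filter_univ, Finset.mem_singleton]
      rcases Phat.cases y with rfl | rfl | ⟨w, rfl⟩
      · simp [not_covBy_bot, topHat]
      · simp [emb_covBy_topHat, AnP.isMax_iff, h]
      · have hw := w.2
        simp only [emb_covBy_emb, AnP.covBy_iff, emb_ne_topHat, iff_false]
        omega
    rw [hs, Finset.sum_singleton, h.1, h.2, Nat.sub_self, intervalLabel_zero,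
      intervalLabel_eq_zero _ (.inl (Nat.lt_succ_self n)), inv_zero, add_zero]
  have mem : ∀ y, emb v ⋖ y ↔ ∃ w : AnP n, y = emb w ∧
      ((w.val.1 = v.val.1 - 1 ∧ w.val.2 = v.val.2) ∨
        (w.val.1 = v.val.1 ∧ w.val.2 = v.val.2 + 1)) := by
    intro y
    rcases Phat.cases y with rfl | rfl | ⟨w, rfl⟩
    · simp [not_covBy_bot, (emb_ne_bot _).symm]
    · simp [emb_covBy_topHat, AnP.isMax_iff, h, (emb_ne_topHat _).symm]
    · have hw := w.2
      simp only [emb_covBy_emb, AnP.covBy_iff, emb_injective.eq_iff, exists_eq_left']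
      omega
  by_cases h1 : v.val.1 = 1
  · let w₂ : AnP n := ⟨(v.val.1, v.val.2 + 1), by dsimp only; omega⟩
    have hs : Finset.univ.filter (emb v ⋖ ·) = {emb w₂} := by
      ext y
      rw [Finset.mem_filter_univ, Finset.mem_singleton, mem]
      constructor
      · rintro ⟨w, rfl, hw⟩
        have hw' := w.2
        rw [emb_injective.eq_iff, AnP.eq_iff]
        dsimp only [w₂]
        omega
      · rintro rfl
        exact ⟨w₂, rfl, .inr ⟨rfl, rfl⟩⟩
    rw [hs, Finset.sum_singleton, ← intervalLabel_val σ w₂,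
      intervalLabel_eq_zero (i := v.val.1 - 1) _ (by omega), inv_zero, zero_add]
  let w₁ : AnP n := ⟨(v.val.1 - 1, v.val.2), by dsimp only; omega⟩
  by_cases h2 : v.val.2 = n
  · have hs : Finset.univ.filter (emb v ⋖ ·) = {emb w₁} := by
      ext y
      rw [Finset.mem_filter_univ, Finset.mem_singleton, mem]
      constructor
      · rintro ⟨w, rfl, hw⟩
        have hw' := w.2
        rw [emb_injective.eq_iff, AnP.eq_iff]
        dsimp only [w₁]
        omega
      · rintro rfl
        exact ⟨w₁, rfl, .inl ⟨rfl, rfl⟩⟩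
    rw [hs, Finset.sum_singleton, ← intervalLabel_val σ w₁,
      intervalLabel_eq_zero (j := v.val.2 + 1) _ (by omega), inv_zero, add_zero]
  let w₂ : AnP n := ⟨(v.val.1, v.val.2 + 1), by dsimp only; omega⟩
  have hs : Finset.univ.filter (emb v ⋖ ·) = {emb w₁, emb w₂} := by
    ext y
    rw [Finset.mem_filter_univ, Finset.mem_insert, Finset.mem_singleton, mem]
    constructor
    · rintro ⟨w, rfl, hw⟩
      rw [emb_injective.eq_iff, emb_injective.eq_iff, AnP.eq_iff, AnP.eq_iff]
      exact hw
    · rintro (rfl | rfl)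
      · exact ⟨w₁, rfl, .inl ⟨rfl, rfl⟩⟩
      · exact ⟨w₂, rfl, .inr ⟨rfl, rfl⟩⟩
  have hne : emb w₁ ≠ emb w₂ := fun he => by
    have := congrArg (fun u : AnP n => u.val.1) (emb_injective he)
    dsimp only [w₁, w₂] at this
    omega
  rw [hs, Finset.sum_pair hne, ← intervalLabel_val σ w₁, ← intervalLabel_val σ w₂]

lemma covSumBelow_emb_pos {σ : Phat (AnP n) → ℝ} (hσ : ∀ x, 0 < σ x) (v : AnP n) :
    0 < covSumBelow σ (emb v) := by
  have hv := v.2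
  rw [covSumBelow_emb]
  exact add_pos (intervalLabel_pos hσ (by omega) (by omega) (by omega))
    (intervalLabel_pos hσ (by omega) (by omega) (by omega))

lemma intervalLabel_nonneg {σ : Phat (AnP n) → ℝ} (hσ : ∀ x, 0 < σ x) (i j : ℕ) :
    0 ≤ intervalLabel n σ i j := by
  unfold intervalLabel
  split_ifs
  exacts [(hσ _).le, (hσ _).le, (half_pos (hσ _)).le, le_rfl]

lemma covSumAboveInv_emb_pos {σ : Phat (AnP n) → ℝ} (hσ : ∀ x, 0 < σ x) (v : AnP n) :
    0 < covSumAboveInv σ (emb v) := by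
  have hv := v.2
  rw [covSumAboveInv_emb]
  have h1 := inv_nonneg.2 (intervalLabel_nonneg hσ (v.val.1 - 1) v.val.2)
  have h2 := inv_nonneg.2 (intervalLabel_nonneg hσ v.val.1 (v.val.2 + 1))
  by_cases h : v.val.2 = n
  · refine add_pos_of_pos_of_nonneg (inv_pos.2 ?_) h2
    by_cases h' : v.val.1 = 1
    · rw [h, h', Nat.sub_self, intervalLabel_zero]
      exact hσ _
    · exact intervalLabel_pos hσ (by omega) (by omega) (by omega)
  · exact add_pos_of_nonneg_of_pos h1
      (inv_pos.2 (intervalLabel_pos hσ (by omega) (by omega) (by omega)))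

lemma RowB_pos {σ : Phat (AnP n) → ℝ} (hσ : ∀ x, 0 < σ x) (r : ℕ) (x : Phat (AnP n)) :
    0 < RowB (rkAn n) r σ x :=
  applyB_pos (fun _ => covSumBelow_emb_pos) (fun _ => covSumAboveInv_emb_pos) _ hσ x

lemma intervalLabel_RowB {σ : Phat (AnP n) → ℝ} (hσ : ∀ x, 0 < σ x) {i j : ℕ} (hi : 1 ≤ i)
    (hij : i ≤ j) (hj : j ≤ n) :
    intervalLabel n (RowB (rkAn n) (n - 1) σ) i j * intervalLabel n σ i j *
      ((intervalLabel n (RowB (rkAn n) (n - 1) σ) (i - 1) j)⁻¹ +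
        (intervalLabel n (RowB (rkAn n) (n - 1) σ) i (j + 1))⁻¹) =
    intervalLabel n σ (i + 1) j + intervalLabel n σ i (j - 1) := by
  obtain ⟨v, rfl, rfl⟩ : ∃ v : AnP n, v.val.1 = i ∧ v.val.2 = j := ⟨⟨(i, j), hi, hij, hj⟩, rfl, rfl⟩
  have p1 := (hσ (emb v)).ne'
  have p2 := (covSumAboveInv_emb_pos (RowB_pos hσ (n - 1)) v).ne'
  rw [intervalLabel_val, intervalLabel_val, ← covSumBelow_emb, ← covSumAboveInv_emb,
    RowB_emb (rkAn_strictMono n) rkAn_le σ]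
  field_simp

end Interval

section Unfolding

variable {n : ℕ}

/-- The labelling of the `(n+1) × (n+1)` square which unfolds an orbit `σ` of labellings of
`Âⁿ`: above the antidiagonal one sees the labelling at the present time, on the antidiagonal
the constant `1/2`, and below it the inverses of labels at later times. -/
noncomputable def squareLabel (n : ℕ) (σ : ℕ → Phat (AnP n) → ℝ) (t i k : ℕ) : ℝ :=
  if i + k ≤ n + 2 then 1 / 4 * (intervalLabel n (σ (t + (n + 2 - i - k))) k (n + 1 - i))⁻¹
  else intervalLabel n (σ t) (n + 2 - i) (k - 1)

lemma squareLabel_of_le (σ : ℕ → Phat (AnP n) → ℝ) (t : ℕ) {i k : ℕ} (h : i + k ≤ n + 2) :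
    squareLabel n σ t i k =
      1 / 4 * (intervalLabel n (σ (t + (n + 2 - i - k))) k (n + 1 - i))⁻¹ := if_pos h

lemma squareLabel_of_lt (σ : ℕ → Phat (AnP n) → ℝ) (t : ℕ) {i k : ℕ} (h : n + 2 < i + k) :
    squareLabel n σ t i k = intervalLabel n (σ t) (n + 2 - i) (k - 1) := if_neg (by omega)

lemma squareLabel_of_ge {σ : ℕ → Phat (AnP n) → ℝ} (hbot : ∀ t, σ t ⊥ = 1) (t : ℕ) {i k : ℕ}
    (hi : i ≤ n + 1) (h : n + 2 ≤ i + k) :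
    squareLabel n σ t i k = intervalLabel n (σ t) (n + 2 - i) (k - 1) := by
  rcases h.lt_or_eq with h | h
  · exact squareLabel_of_lt σ t h
  · rw [squareLabel_of_le σ t h.ge, show n + 2 - i = k - 1 + 1 by omega,
      show k = k - 1 + 1 by omega, show n + 1 - i = k - 1 by omega, Nat.add_sub_cancel]
    by_cases hkn : k - 1 ≤ n
    · rw [intervalLabel_empty _ _ hkn, intervalLabel_empty _ _ hkn, hbot, hbot]
      norm_num
    · rw [intervalLabel_eq_zero _ (by omega), intervalLabel_eq_zero _ (by omega)]
      norm_num

/-- Unfolding reduces rowmotion on `Aⁿ` to rowmotion on a square. -/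
lemma isRectOrbit_squareLabel (hn : 1 ≤ n) {κ : ℝ} (hκ : 0 < κ) {σ : ℕ → Phat (AnP n) → ℝ}
    (hσ : ∀ t x, 0 < σ t x) (hbot : ∀ t, σ t ⊥ = 1) (htop : ∀ t, σ t (topHat (AnP n)) = κ)
    (hsucc : ∀ t, σ (t + 1) = RowB (rkAn n) (n - 1) (σ t)) :
    IsRectOrbit (n + 1) (n + 1) (1 / 4 * κ⁻¹) κ (squareLabel n σ) where
  a_pos := by positivity
  b_pos := hκ
  q_pos := Nat.succ_pos n
  pos t i j hi hj := by
    unfold squareLabel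
    split_ifs
    · exact mul_pos (by norm_num)
        (inv_pos.2 (intervalLabel_pos (hσ _) (by omega) (by omega) (by omega)))
    · exact intervalLabel_pos (hσ _) (by omega) (by omega) (by omega)
  left t j := by
    unfold squareLabel
    split_ifs
    · rw [intervalLabel_eq_zero _ (by omega), inv_zero, mul_zero]
    · exact intervalLabel_eq_zero _ (by omega)
  bot t := by
    rw [squareLabel_of_le _ _ (by omega), Nat.add_sub_cancel, intervalLabel_zero, htop]
  below t i := by
    unfold squareLabel
    split_ifs
    · rw [intervalLabel_eq_zero _ (by omega), inv_zero, mul_zero]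
    · exact intervalLabel_eq_zero _ (by omega)
  top t := by
    rw [squareLabel_of_lt _ _ (by omega), Nat.sub_self, Nat.add_sub_cancel,
      intervalLabel_zero, htop]
  right t j hj := by
    unfold squareLabel
    split_ifs
    · rw [intervalLabel_eq_zero _ (by omega), inv_zero, mul_zero]
    · exact intervalLabel_eq_zero _ (by omega)
  above t i j hj := by
    unfold squareLabel
    split_ifs
    · rw [intervalLabel_eq_zero _ (by omega), inv_zero, mul_zero]
    · exact intervalLabel_eq_zero _ (by omega)
  row t i j hi hj := by
    rcases lt_trichotomy (i + j) n with h | h | h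
    · obtain ⟨s, rfl⟩ : ∃ s, n = i + j + s + 1 := ⟨n - i - j - 1, by omega⟩
      have e := intervalLabel_RowB (hσ (t + s + 1)) (i := j + 1) (j := j + s + 1)
        (by omega) (by omega) (by omega)
      rw [← hsucc] at e
      have p1 := intervalLabel_pos (hσ (t + s + 1)) (i := j + 1) (j := j + s + 1)
        (by omega) (by omega) (by omega)
      have p2 := intervalLabel_pos (hσ (t + s + 1 + 1)) (i := j + 1) (j := j + s + 1)
        (by omega) (by omega) (by omega)
      rw [squareLabel_of_le _ _ (by omega), squareLabel_of_le _ _ (by omega),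
        squareLabel_of_le _ _ (by omega), squareLabel_of_le _ _ (by omega),
        squareLabel_of_le _ _ (by omega), squareLabel_of_le _ _ (by omega)]
      rw [show t + 1 + (i + j + s + 1 + 2 - (i + 1) - (j + 1)) = t + s + 1 + 1 by omega,
        show t + (i + j + s + 1 + 2 - (i + 1) - (j + 1)) = t + s + 1 by omega,
        show t + 1 + (i + j + s + 1 + 2 - (i + 2) - (j + 1)) = t + s + 1 by omega,
        show t + 1 + (i + j + s + 1 + 2 - (i + 1) - (j + 2)) = t + s + 1 by omega,
        show t + (i + j + s + 1 + 2 - i - (j + 1)) = t + s + 1 + 1 by omega,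
        show t + (i + j + s + 1 + 2 - (i + 1) - j) = t + s + 1 + 1 by omega,
        show i + j + s + 1 + 1 - (i + 1) = j + s + 1 by omega,
        show i + j + s + 1 + 1 - (i + 2) = j + s + 1 - 1 by omega,
        show i + j + s + 1 + 1 - i = j + s + 1 + 1 by omega]
      rw [Nat.add_sub_cancel] at e
      rw [← mul_add, add_comm (_⁻¹) (intervalLabel _ _ j _)⁻¹, mul_inv, mul_inv, ← mul_add, inv_inv,
        inv_inv, add_comm (intervalLabel _ _ _ (_ - 1)), ← e]
      field_simp
    · obtain rfl := h
      rw [squareLabel_of_ge hbot _ (by omega) (by omega),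
        squareLabel_of_ge hbot _ (by omega) (by omega)]
      rw [squareLabel_of_lt _ _ (by omega), squareLabel_of_lt _ _ (by omega)]
      rw [squareLabel_of_le _ _ (by omega), squareLabel_of_le _ _ (by omega)]
      rw [show i + j + 2 - (i + 1) = j + 1 by omega, show j + 1 - 1 = j by omega,
        intervalLabel_empty _ _ (by omega), intervalLabel_empty _ _ (by omega), hbot, hbot,
        show i + j + 2 - (i + 2) = j by omega, show j + 2 - 1 = j + 1 by omega,
        show i + j + 2 - i - (j + 1) = 1 by omega, show i + j + 1 - i = j + 1 by omega,
        show j + 1 - j = 1 by omega, show i + j + 1 - (i + 1) = j by omega]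
      ring
    · have e := intervalLabel_RowB (hσ t) (i := n + 2 - (i + 1)) (j := j)
        (by omega) (by omega) (by omega)
      rw [← hsucc] at e
      rw [squareLabel_of_ge hbot _ (by omega) (by omega),
        squareLabel_of_ge hbot _ (by omega) (by omega),
        squareLabel_of_lt _ _ (by omega),
        squareLabel_of_ge hbot _ (by omega) (by omega),
        squareLabel_of_ge hbot _ (by omega) (by omega),
        squareLabel_of_ge hbot _ (by omega) (by omega)]
      rw [show j + 1 - 1 = j by omega, show n + 2 - (i + 2) = n + 2 - (i + 1) - 1 by omega,
        show j + 2 - 1 = j + 1 by omega, e, show n + 2 - i = n + 2 - (i + 1) + 1 by omega]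

end Unfolding

/-- For every `n ≥ 1` and `κ > 0`, birational order filter rowmotion of
`Aⁿ` satisfies `(Row^B_F)^(n+1) = Flip`: for every `π ∈ F^B_κ(Aⁿ)` and every
`p ∈ Aⁿ`, `((Row^B_F)^(n+1) π)(p) = π(Flip p)`. -/
theorem stmt12 (n : ℕ) (hn : 1 ≤ n) (κ : ℝ) (hκ : 0 < κ)
    (π : Phat (AnP n) → ℝ) (hpos : ∀ x, 0 < π x)
    (h0 : π ⊥ = 1) (h1 : π (topHat (AnP n)) = κ)
    (p : AnP n) :
    (RowB (rkAn n) (n - 1))^[n + 1] π (emb p) = π (emb (flipAn n p)) := by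
  let σ : ℕ → Phat (AnP n) → ℝ := fun t => (RowB (rkAn n) (n - 1))^[t] π
  have hsucc : ∀ t, σ (t + 1) = RowB (rkAn n) (n - 1) (σ t) := fun t =>
    Function.iterate_succ_apply' _ _ _
  have hσ : ∀ t x, 0 < σ t x := fun t => by
    induction t with
    | zero => exact hpos
    | succ t ih => rw [hsucc]; exact RowB_pos ih _
  have hbot : ∀ t, σ t ⊥ = 1 := fun t => by
    induction t with
    | zero => exact h0
    | succ t ih => rw [hsucc, RowB_bot, ih]
  have htop : ∀ t, σ t (topHat (AnP n)) = κ := fun t => by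
    induction t with
    | zero => exact h1
    | succ t ih => rw [hsucc, RowB_topHat, ih]
  have hp := p.2
  have key := (isRectOrbit_squareLabel hn hκ hσ hbot htop hsucc).reciprocity 0
    (n - p.val.2) (p.val.1 - 1) p.val.2 (n + 1 - p.val.1) (by omega) (by omega)
  rw [squareLabel_of_lt _ _ (by omega), squareLabel_of_le _ _ (by omega),
    show 0 + (n - p.val.2) + (p.val.1 - 1) + 1 +
      (n + 2 - (n - p.val.2 + 1) - (p.val.1 - 1 + 1)) = n + 1 by omega,
    show n + 2 - (p.val.2 + 1) = n + 1 - p.val.2 by omega,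
    show n + 1 - p.val.1 + 1 - 1 = n + 1 - p.val.1 by omega,
    show p.val.1 - 1 + 1 = p.val.1 by omega,
    show n + 1 - (n - p.val.2 + 1) = p.val.2 by omega, intervalLabel_val] at key
  have e : intervalLabel n (σ 0) (n + 1 - p.val.2) (n + 1 - p.val.1) = π (emb (flipAn n p)) :=
    intervalLabel_val π (flipAn n p)
  rw [e] at key
  have hq := hσ (n + 1) (emb p)
  change σ (n + 1) (emb p) = _
  field_simp at key
  exact key.symm
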